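/- Let k, ℓ, n be natural numbers with ℓ < k, n < k and ℓ ≠ n. Then ∫_{-∞}^{+∞} Q^k_ℓ(i·x)·Q^k_n(i·x) dx = 0. -/

import Mathlib

open MeasureTheory Filter Finset

/-- Legendre polynomial of the first kind via the Rodrigues formula,
evaluated at a complex argument. -/
noncomputable def legP (l : ℕ) (z : ℂ) : ℂ :=
  (1 / (2 ^ l * (l.factorial : ℂ))) * iteratedDeriv l (fun w : ℂ => (w ^ 2 - 1) ^ l) z

/-- Legendre function of the second kind `Q_ℓ` (Ferrers branch), for complex argument. -/
noncomputable def legQ (l : ℕ) (z : ℂ) : ℂ :=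
  (1 / 2) * legP l z * Complex.log ((1 + z) / (1 - z)) -
    ∑ j ∈ Finset.Icc 1 l, legP (j - 1) z * legP (l - j) z / (j : ℂ)

/-- The associated Legendre function of the second kind on the imaginary axis:
`Q^k_ℓ(i·x) = (−1)^k (1+x²)^{k/2} i^{−k} (d/dx)^k [Q_ℓ(i·x)]`. -/
noncomputable def Qi (k l : ℕ) (x : ℝ) : ℂ :=
  (-1) ^ k * (((1 + x ^ 2) ^ ((k : ℝ) / 2) : ℝ) : ℂ) * Complex.I ^ (-(k : ℤ)) *
    iteratedDeriv k (fun t : ℝ => legQ l (Complex.I * t)) x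

section Legendre

open Polynomial

/-- The Legendre polynomial, as a polynomial. -/
noncomputable def legPoly (l : ℕ) : ℂ[X] :=
  C (1 / (2 ^ l * (l.factorial : ℂ))) * derivative^[l] ((X ^ 2 - 1) ^ l)

theorem iteratedDeriv_polynomial_eval (p : ℂ[X]) (n : ℕ) :
    iteratedDeriv n (fun w => p.eval w) = fun w => (derivative^[n] p).eval w := by
  induction n with
  | zero => simp
  | succ n ih =>
    rw [iteratedDeriv_succ, ih, Function.iterate_succ_apply']
    ext w
    exact Polynomial.deriv _

theorem legP_eq_eval (l : ℕ) (z : ℂ) : legP l z = (legPoly l).eval z := by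
  have h : (fun w : ℂ => (w ^ 2 - 1) ^ l) = fun w => ((X ^ 2 - 1 : ℂ[X]) ^ l).eval w := by
    ext w; simp
  rw [legP, legPoly, h, iteratedDeriv_polynomial_eval, eval_mul, eval_C]

theorem legP_zero (z : ℂ) : legP 0 z = 1 := by simp [legP]

theorem legP_one (z : ℂ) : legP 1 z = z := by
  simp [legP_eq_eval, legPoly]
  ring

theorem iterate_derivative_X_mul' (p : ℂ[X]) (n : ℕ) :
    derivative^[n + 1] (X * p) = X * derivative^[n + 1] p + (n + 1 : ℂ[X]) * derivative^[n] p := by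
  rw [mul_comm, iterate_derivative_mul_X]
  simp [mul_comm]

theorem derivative_X_sq_sub_one_pow (m : ℕ) :
    derivative ((X ^ 2 - 1 : ℂ[X]) ^ (m + 1)) =
      C (2 * (m + 1 : ℂ)) * (X * (X ^ 2 - 1) ^ m) := by
  rw [derivative_pow_succ]
  simp only [derivative_sub, derivative_X_pow, derivative_one, map_mul, map_add, map_one,
    map_ofNat, map_natCast]
  push_cast
  ring

theorem derivative_X_mul_X_sq_sub_one_pow (m : ℕ) :
    derivative (X * (X ^ 2 - 1 : ℂ[X]) ^ (m + 1)) =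
      C (2 * m + 3 : ℂ) * (X ^ 2 - 1) ^ (m + 1) + C (2 * (m + 1 : ℂ)) * (X ^ 2 - 1) ^ m := by
  rw [derivative_mul, derivative_X_sq_sub_one_pow]
  simp only [derivative_X, map_mul, map_add, map_one, map_ofNat, map_natCast]
  ring

/-- Bonnet's recursion for the Legendre polynomials. -/
theorem legP_recurrence (l : ℕ) (z : ℂ) :
    (l + 2 : ℂ) * legP (l + 2) z =
      (2 * l + 3) * z * legP (l + 1) z - (l + 1) * legP l z := by
  set S := (derivative^[l] ((X ^ 2 - 1 : ℂ[X]) ^ (l + 1))).eval z with hS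
  set A := (derivative^[l + 1] ((X ^ 2 - 1 : ℂ[X]) ^ (l + 1))).eval z with hA
  set B := (derivative^[l] ((X ^ 2 - 1 : ℂ[X]) ^ l)).eval z with hB
  set D := (derivative^[l + 2] ((X ^ 2 - 1 : ℂ[X]) ^ (l + 2))).eval z with hD
  have h1 : D = 2 * (l + 2) * (z * A + (l + 1) * S) := by
    rw [hD, Function.iterate_succ_apply, derivative_X_sq_sub_one_pow (l + 1),
      iterate_derivative_C_mul, iterate_derivative_X_mul']
    simp only [eval_mul, eval_add, eval_C, eval_X, eval_natCast, eval_one, ← hA, ← hS]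
    push_cast
    ring
  have h2 : D = 2 * (l + 2) * ((2 * l + 3) * S + 2 * (l + 1) * B) := by
    rw [hD, Function.iterate_succ_apply, derivative_X_sq_sub_one_pow (l + 1),
      iterate_derivative_C_mul, Function.iterate_succ_apply,
      derivative_X_mul_X_sq_sub_one_pow, iterate_map_add, iterate_derivative_C_mul,
      iterate_derivative_C_mul]
    simp only [eval_mul, eval_add, eval_C, ← hB, ← hS]
    push_cast
    ring
  have hf : (l.factorial : ℂ) ≠ 0 := by exact_mod_cast l.factorial_ne_zero
  have e1 : (l + 1 : ℂ) ≠ 0 := by exact_mod_cast l.succ_ne_zero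
  have e2 : (l + 1 + 1 : ℂ) ≠ 0 := by exact_mod_cast (l + 1).succ_ne_zero
  simp only [legP_eq_eval, legPoly, eval_mul, eval_C, ← hA, ← hB, ← hD]
  rw [Nat.factorial_succ (l + 1), Nat.factorial_succ l]
  have c1 : 1 / (2 ^ (l + 1) * (((l + 1) * l.factorial : ℕ) : ℂ)) =
      1 / (2 ^ l * (l.factorial : ℂ)) / (2 * (l + 1)) := by
    push_cast
    field_simp
    ring
  have c2 : 1 / (2 ^ (l + 2) * (((l + 1 + 1) * ((l + 1) * l.factorial) : ℕ) : ℂ)) =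
      1 / (2 ^ l * (l.factorial : ℂ)) / (4 * (l + 1) * (l + 1 + 1)) := by
    push_cast
    field_simp
    ring
  rw [c1, c2]
  generalize 1 / (2 ^ l * (l.factorial : ℂ)) = c
  field_simp
  linear_combination 2 * c * ((2 * l + 3 : ℂ) * h1 - (l + 1 : ℂ) * h2)

end Legendre

section SecondKind

/-- The rational part of the Legendre function of the second kind. -/
noncomputable def legW (l : ℕ) (z : ℂ) : ℂ :=
  ∑ j ∈ Finset.Icc 1 l, legP (j - 1) z * legP (l - j) z / (j : ℂ)

open PowerSeries

/-- The generating series of the Legendre polynomials. -/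
noncomputable def legGen (z : ℂ) : ℂ⟦X⟧ := mk fun l => legP l z

/-- The formal primitive of `legGen`. -/
noncomputable def legGenInt (z : ℂ) : ℂ⟦X⟧ := mk fun l => legP (l - 1) z / l

theorem derivative_legGenInt (z : ℂ) : d⁄dX ℂ (legGenInt z) = legGen z := by
  ext n
  have : (n + 1 : ℂ) ≠ 0 := by exact_mod_cast n.succ_ne_zero
  rw [coeff_derivative, legGenInt, legGen, coeff_mk, coeff_mk]
  simp [div_mul_cancel₀ _ this]

theorem mul_derivative_legGen (z : ℂ) :
    (1 - C (2 * z) * X + X ^ 2) * d⁄dX ℂ (legGen z) = (C z - X) * legGen z := by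
  ext n
  simp only [add_mul, sub_mul, one_mul, mul_assoc, map_add, map_sub, coeff_C_mul]
  rcases n with _ | _ | n
  · simp [coeff_derivative, legGen, legP_one, legP_zero]
  · have := legP_recurrence 0 z
    simp [coeff_derivative, legGen, legP_one, legP_zero, coeff_succ_X_mul, coeff_X_pow_mul']
      at this ⊢
    linear_combination this
  · have := legP_recurrence (n + 1) z
    simp [coeff_derivative, legGen, coeff_succ_X_mul, coeff_X_pow_mul'] at this ⊢
    linear_combination this

theorem mul_legGen_sq (z : ℂ) : (1 - C (2 * z) * X + X ^ 2) * legGen z ^ 2 = 1 := by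
  apply derivative.ext
  · have h := mul_derivative_legGen z
    simp only [Derivation.leibniz, map_add, map_sub, smul_eq_mul, Derivation.leibniz_pow,
      derivative_X, derivative_C, Derivation.map_one_eq_zero]
    simp only [map_mul, map_ofNat, nsmul_eq_mul] at h ⊢
    push_cast
    linear_combination 2 * legGen z * h
  · have h : constantCoeff (legGen z) = 1 := by
      rw [← coeff_zero_eq_constantCoeff_apply, legGen, coeff_mk, legP_zero]
    simp [h]

theorem coeff_legGenInt_mul_legGen (z : ℂ) (l : ℕ) :
    coeff l (legGenInt z * legGen z) = legW l z := by
  rw [coeff_mul, Finset.Nat.sum_antidiagonal_eq_sum_range_succ_mk, legW,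
    Finset.sum_range_succ', Finset.range_eq_Ico, Finset.sum_Ico_add' (fun j =>
      coeff j (legGenInt z) * coeff (l - j) (legGen z)) 0 l 1]
  simp only [legGenInt, legGen, coeff_mk]
  simp only [Nat.cast_zero, div_zero, zero_mul, add_zero, zero_add]
  exact Finset.sum_congr rfl fun j _ => by ring

theorem legW_zero (z : ℂ) : legW 0 z = 0 := by simp [legW]

theorem legW_one (z : ℂ) : legW 1 z = 1 := by simp [legW, legP_zero]

theorem legW_recurrence (l : ℕ) (z : ℂ) :
    (l + 2 : ℂ) * legW (l + 2) z =
      (2 * l + 3) * z * legW (l + 1) z - (l + 1) * legW l z := by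
  have h : (1 - C (2 * z) * X + X ^ 2) * d⁄dX ℂ (legGenInt z * legGen z) =
      1 + (C z - X) * (legGenInt z * legGen z) := by
    rw [Derivation.leibniz, derivative_legGenInt, smul_eq_mul, smul_eq_mul]
    linear_combination mul_legGen_sq z + legGenInt z * mul_derivative_legGen z
  have hc := coeff_legGenInt_mul_legGen z
  generalize legGenInt z * legGen z = H at h hc
  have h' := congrArg (coeff (l + 1)) h
  simp only [add_mul, sub_mul, one_mul, mul_assoc (C _), map_add, map_sub, coeff_C_mul] at h'
  rcases l with _ | l
  · simp [coeff_derivative, hc, coeff_succ_X_mul, coeff_X_pow_mul',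
      coeff_one] at h' ⊢
    simp [legW_zero, legW_one] at h' ⊢
    linear_combination h'
  · simp [coeff_derivative, hc, coeff_succ_X_mul, coeff_X_pow_mul',
      coeff_one] at h' ⊢
    linear_combination h'

end SecondKind

section ImaginaryAxis

open Polynomial

/-- `Q_l` restricted to the imaginary axis. -/
noncomputable def legQImag (l : ℕ) (x : ℝ) : ℂ := legQ l (Complex.I * x)

theorem log_imag_axis (x : ℝ) :
    Complex.log ((1 + Complex.I * x) / (1 - Complex.I * x)) =
      2 * Complex.I * (Real.arctan x : ℂ) := by
  rw [Complex.ofReal_arctan, Complex.arctan, mul_comm (x : ℂ)]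
  linear_combination (Complex.log ((1 + Complex.I * x) / (1 - Complex.I * x))) * Complex.I_sq

theorem legQImag_eq (l : ℕ) (x : ℝ) :
    legQImag l x = Complex.I * legP l (Complex.I * x) * (Real.arctan x : ℂ) -
      legW l (Complex.I * x) := by
  rw [legQImag, legQ, log_imag_axis, legW]
  ring

theorem legQImag_zero (x : ℝ) : legQImag 0 x = Complex.I * (Real.arctan x : ℂ) := by
  simp [legQImag_eq, legP_zero, legW_zero]

theorem legQImag_one (x : ℝ) :
    legQImag 1 x = Complex.I * x * legQImag 0 x - 1 := by
  simp [legQImag_eq, legP_zero, legW_zero, legP_one, legW_one]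
  ring

theorem legQImag_recurrence (l : ℕ) (x : ℝ) :
    (l + 2 : ℂ) * legQImag (l + 2) x =
      (2 * l + 3) * (Complex.I * x) * legQImag (l + 1) x - (l + 1) * legQImag l x := by
  simp only [legQImag_eq]
  linear_combination Complex.I * (Real.arctan x : ℂ) * legP_recurrence l (Complex.I * x) -
    legW_recurrence l (Complex.I * x)

theorem legQImag_succ_succ (l : ℕ) (x : ℝ) :
    legQImag (l + 2) x = ((2 * l + 3) * (Complex.I * x) * legQImag (l + 1) x -
      (l + 1) * legQImag l x) / (l + 2) := by
  have : (l + 2 : ℂ) ≠ 0 := by exact_mod_cast (l + 1).succ_ne_zero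
  rw [eq_div_iff this, ← legQImag_recurrence]
  ring

theorem one_add_ofReal_sq_ne_zero (x : ℝ) : (1 + (x : ℂ) ^ 2) ≠ 0 := by
  have : (1 + x ^ 2 : ℝ) ≠ 0 := by positivity
  exact_mod_cast this

theorem hasDerivAt_ofReal_arctan (x : ℝ) :
    HasDerivAt (fun t : ℝ => (Real.arctan t : ℂ)) (1 / (1 + (x : ℂ) ^ 2)) x := by
  simpa using (Real.hasDerivAt_arctan x).ofReal_comp

theorem hasDerivAt_I_mul_ofReal (x : ℝ) :
    HasDerivAt (fun t : ℝ => Complex.I * (t : ℂ)) Complex.I x := by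
  simpa using (hasDerivAt_id x).ofReal_comp.const_mul Complex.I

/-- The raising relation for `Q_l` on the imaginary axis. -/
theorem hasDerivAt_legQImag (l : ℕ) (x : ℝ) :
    HasDerivAt (legQImag l)
      (Complex.I * (l + 1) * (Complex.I * x * legQImag l x - legQImag (l + 1) x) /
        (1 + (x : ℂ) ^ 2)) x := by
  have hv := one_add_ofReal_sq_ne_zero x
  have h0 : ∀ x : ℝ, HasDerivAt (legQImag 0) (Complex.I / (1 + (x : ℂ) ^ 2)) x := fun x => by
    rw [funext legQImag_zero]
    exact ((hasDerivAt_ofReal_arctan x).const_mul Complex.I).congr_deriv (by ring)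
  induction l using Nat.twoStepInduction with
  | zero =>
    refine (h0 x).congr_deriv ?_
    rw [zero_add, legQImag_one]
    push_cast
    ring
  | one =>
    rw [funext legQImag_one]
    refine (((hasDerivAt_I_mul_ofReal x).mul (h0 x)).sub_const 1).congr_deriv ?_
    rw [show legQImag (1 + 1) x = _ from legQImag_succ_succ 0 x, legQImag_one]
    push_cast
    field_simp
    ring_nf
    simp only [Complex.I_sq]
    ring
  | more l h1 h2 =>
    rw [funext (legQImag_succ_succ l)]
    refine ((((((hasDerivAt_I_mul_ofReal x).const_mul (2 * l + 3 : ℂ)).mul h2).sub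
      (h1.const_mul (l + 1 : ℂ)))).div_const (l + 2 : ℂ)).congr_deriv ?_
    have e2 : (l + 2 : ℂ) ≠ 0 := by exact_mod_cast (l + 1).succ_ne_zero
    have e3 : (l + 1 + 2 : ℂ) ≠ 0 := by exact_mod_cast (l + 2).succ_ne_zero
    rw [show legQImag (l + 2 + 1) x = _ from legQImag_succ_succ (l + 1) x,
      show legQImag (l + 1 + 1) x = _ from legQImag_succ_succ l x]
    push_cast
    field_simp
    ring_nf
    simp only [Complex.I_sq]
    ring

theorem exists_legQImag_eq (l : ℕ) :
    ∃ p q : ℂ[X], p.natDegree ≤ l ∧ q.degree < l ∧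
      ∀ x : ℝ, legQImag l x = p.eval (x : ℂ) * (Real.arctan x : ℂ) + q.eval (x : ℂ) := by
  induction l using Nat.twoStepInduction with
  | zero => exact ⟨C Complex.I, 0, by simp, by simp, fun x => by simp [legQImag_zero]⟩
  | one =>
    refine ⟨-X, -1, by simp, by simp, fun x => ?_⟩
    rw [legQImag_one, legQImag_zero]
    simp only [eval_neg, eval_X, eval_one]
    linear_combination x * (Real.arctan x : ℂ) * Complex.I_sq
  | more l h1 h2 =>
    obtain ⟨p, q, hp, hq, h⟩ := h1
    obtain ⟨r, s, hr, hs, h'⟩ := h2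
    refine ⟨C ((2 * l + 3) * Complex.I / (l + 2)) * X * r - C ((l + 1) / (l + 2) : ℂ) * p,
      C ((2 * l + 3) * Complex.I / (l + 2)) * X * s - C ((l + 1) / (l + 2) : ℂ) * q,
      ?_, ?_, fun x => ?_⟩
    · rw [mul_assoc]
      refine (natDegree_sub_le _ _).trans (max_le ?_ ?_)
      · exact (natDegree_C_mul_le _ _).trans (natDegree_mul_le.trans (by simp; lia))
      · exact (natDegree_C_mul_le _ _).trans (by lia)
    · rw [← mem_degreeLT] at hq hs ⊢
      rw [mul_assoc, ← smul_eq_C_mul, ← smul_eq_C_mul]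
      refine Submodule.sub_mem _ (Submodule.smul_mem _ _ ?_)
        (Submodule.smul_mem _ _ (degreeLT_mono (by lia) hq))
      rw [mem_degreeLT] at hs ⊢
      rcases eq_or_ne s 0 with rfl | h0
      · simpa using WithBot.bot_lt_coe (l + 2)
      rw [degree_eq_natDegree h0] at hs
      rw [degree_mul, degree_X, degree_eq_natDegree h0]
      norm_cast at hs ⊢
      lia
    · rw [legQImag_succ_succ, h, h']
      simp
      ring

theorem hasDerivAt_eval_ofReal (p : ℂ[X]) (x : ℝ) :
    HasDerivAt (fun t : ℝ => p.eval (t : ℂ)) ((derivative p).eval (x : ℂ)) x :=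
  (p.hasDerivAt (x : ℂ)).comp_ofReal

theorem hasDerivAt_one_add_ofReal_sq (x : ℝ) :
    HasDerivAt (fun t : ℝ => (1 : ℂ) + (t : ℂ) ^ 2) (2 * (x : ℂ)) x := by
  exact ((hasDerivAt_eval_ofReal (1 + X ^ 2) x).congr_deriv
    (by simp [one_add_one_eq_two])).congr_of_eventuallyEq
    (.of_forall fun t => by simp)

theorem hasDerivAt_eval_div_one_add_sq_pow (p : ℂ[X]) (m : ℕ) (x : ℝ) :
    HasDerivAt (fun t : ℝ => p.eval (t : ℂ) / (1 + (t : ℂ) ^ 2) ^ m)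
      (((derivative p).eval (x : ℂ) * (1 + (x : ℂ) ^ 2) - 2 * m * x * p.eval (x : ℂ)) /
        (1 + (x : ℂ) ^ 2) ^ (m + 1)) x := by
  have hv := one_add_ofReal_sq_ne_zero x
  refine ((hasDerivAt_eval_ofReal p x).div ((hasDerivAt_one_add_ofReal_sq x).pow m)
    (pow_ne_zero m hv)).congr_deriv ?_
  rcases m with _ | m
  · simp
    field_simp
  · simp only [Nat.add_sub_cancel, Pi.pow_apply]
    push_cast
    field_simp
    ring

/-- The numerator over `(1 + x²)^m` of the rational part of the `m`-th derivative of
`p(x) arctan x + q(x)`. -/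
noncomputable def arctanNum (p q : ℂ[X]) : ℕ → ℂ[X]
  | 0 => q
  | m + 1 => derivative^[m] p * (1 + X ^ 2) ^ m + derivative (arctanNum p q m) * (1 + X ^ 2) -
      C (2 * m : ℂ) * X * arctanNum p q m

/-- The `m`-th derivative of `p(x) arctan x + q(x)`. -/
noncomputable def arctanDeriv (p q : ℂ[X]) (m : ℕ) (x : ℝ) : ℂ :=
  (derivative^[m] p).eval (x : ℂ) * (Real.arctan x : ℂ) +
    (arctanNum p q m).eval (x : ℂ) / (1 + (x : ℂ) ^ 2) ^ m

theorem hasDerivAt_arctanDeriv (p q : ℂ[X]) (m : ℕ) (x : ℝ) :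
    HasDerivAt (arctanDeriv p q m) (arctanDeriv p q (m + 1) x) x := by
  have hv := one_add_ofReal_sq_ne_zero x
  refine (((hasDerivAt_eval_ofReal (derivative^[m] p) x).mul (hasDerivAt_ofReal_arctan x)).add
    (hasDerivAt_eval_div_one_add_sq_pow (arctanNum p q m) m x)).congr_deriv ?_
  rw [arctanDeriv, arctanNum, Function.iterate_succ_apply']
  simp only [eval_mul, eval_add, eval_sub, eval_pow, eval_X, eval_one, eval_C]
  field_simp
  ring

theorem iteratedDeriv_arctanDeriv (p q : ℂ[X]) (m : ℕ) :
    iteratedDeriv m (arctanDeriv p q 0) = arctanDeriv p q m := by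
  induction m with
  | zero => simp
  | succ m ih =>
    rw [iteratedDeriv_succ, ih]
    exact funext fun x => (hasDerivAt_arctanDeriv p q m x).deriv

theorem legQImag_ode (l : ℕ) (g h : ℝ → ℂ) (hg : ∀ x, HasDerivAt (legQImag l) (g x) x)
    (hh : ∀ x, HasDerivAt g (h x) x) (x : ℝ) :
    (1 + (x : ℂ) ^ 2) * h x + 2 * x * g x - l * (l + 1) * legQImag l x = 0 := by
  have hv := one_add_ofReal_sq_ne_zero x
  have hg' : ∀ x : ℝ, (1 + (x : ℂ) ^ 2) * g x =
      Complex.I * (l + 1) * (Complex.I * x * legQImag l x - legQImag (l + 1) x) := fun x => by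
    rw [(hg x).unique (hasDerivAt_legQImag l x),
      mul_div_cancel₀ _ (one_add_ofReal_sq_ne_zero x)]
  have h1 := (hasDerivAt_one_add_ofReal_sq x).mul (hh x)
  have h2 := (((hasDerivAt_I_mul_ofReal x).mul (hg x)).sub
    (hasDerivAt_legQImag (l + 1) x)).const_mul (Complex.I * (l + 1))
  have h3 := h1.unique (h2.congr_of_eventuallyEq (.of_forall hg'))
  have e2 : (l + 2 : ℂ) ≠ 0 := by exact_mod_cast (l + 1).succ_ne_zero
  rw [show legQImag (l + 1 + 1) x = _ from legQImag_succ_succ l x] at h3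
  have hgx := hg' x
  push_cast at h3
  field_simp at h3
  have hI := Complex.I_sq
  rw [hI] at h3
  apply mul_left_cancel₀ (mul_ne_zero e2 hv)
  linear_combination h3 - (l + 1) * (l + 2) * x * hgx -
    (l + 1) ^ 2 * (l + 2) * x ^ 2 * legQImag l x * hI

theorem arctanDeriv_ode (p q : ℂ[X]) (c : ℂ)
    (h0 : ∀ x : ℝ, (1 + (x : ℂ) ^ 2) * arctanDeriv p q 2 x + 2 * x * arctanDeriv p q 1 x -
      c * arctanDeriv p q 0 x = 0) (m : ℕ) (x : ℝ) :
    (1 + (x : ℂ) ^ 2) * arctanDeriv p q (m + 2) x + 2 * (m + 1) * x * arctanDeriv p q (m + 1) x +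
      (m * (m + 1) - c) * arctanDeriv p q m x = 0 := by
  induction m generalizing x with
  | zero => simpa [sub_eq_add_neg] using h0 x
  | succ m ih =>
    have hx : HasDerivAt (fun t : ℝ => 2 * (m + 1 : ℂ) * t) (2 * (m + 1)) x := by
      simpa using (hasDerivAt_id x).ofReal_comp.const_mul (2 * (m + 1 : ℂ))
    have h1 := (((hasDerivAt_one_add_ofReal_sq x).mul (hasDerivAt_arctanDeriv p q (m + 2) x)).add
      (hx.mul (hasDerivAt_arctanDeriv p q (m + 1) x))).add
      ((hasDerivAt_arctanDeriv p q m x).const_mul (m * (m + 1) - c : ℂ))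
    have h2 := h1.unique ((hasDerivAt_const x (0 : ℂ)).congr_of_eventuallyEq (.of_forall ih))
    push_cast
    linear_combination h2

theorem arctanNum_ode (p q : ℂ[X]) (c : ℂ) (k : ℕ) (hp : p.natDegree < k)
    (h : ∀ x : ℝ, (1 + (x : ℂ) ^ 2) * arctanDeriv p q (k + 2) x +
      2 * (k + 1) * x * arctanDeriv p q (k + 1) x + (k * (k + 1) - c) * arctanDeriv p q k x = 0) :
    (1 + X ^ 2) * derivative (derivative (arctanNum p q k)) -
      C (2 * (k - 1) : ℂ) * X * derivative (arctanNum p q k) +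
      C (k * (k - 1) - c : ℂ) * arctanNum p q k = 0 := by
  refine eq_of_infinite_eval_eq _ _ (Set.infinite_of_injective_forall_mem
    Complex.ofReal_injective fun x => ?_)
  have hv := one_add_ofReal_sq_ne_zero x
  have hz : ∀ m, k ≤ m → derivative^[m] p = 0 := fun m hm =>
    iterate_derivative_eq_zero (hp.trans_le hm)
  have hx := h x
  simp only [arctanDeriv, arctanNum, hz k le_rfl, hz (k + 1) (by lia), hz (k + 2) (by lia),
    derivative_add, derivative_sub, derivative_mul, derivative_X, derivative_C, derivative_one,
    derivative_X_pow, derivative_zero,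
    eval_add, eval_sub, eval_mul, eval_pow, eval_X, eval_C, eval_one, eval_zero] at hx
  simp only [Set.mem_ofPred_eq, eval_add, eval_sub, eval_mul, eval_pow, eval_X, eval_C, eval_one,
    eval_zero]
  simp only [zero_mul, zero_add, add_zero] at hx
  field_simp at hx
  push_cast at hx
  apply mul_left_cancel₀ (pow_ne_zero (2 * k + 3) hv)
  linear_combination hx

theorem degree_arctanNum_lt (p q : ℂ[X]) (l : ℕ) (hp : p.natDegree ≤ l) (hq : q.degree < l)
    (m : ℕ) : (arctanNum p q m).degree < (l + m : ℕ) := by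
  induction m with
  | zero => exact hq
  | succ m ih =>
    have hX : (1 + X ^ 2 : ℂ[X]).natDegree ≤ 2 := by compute_degree
    have hXm : ((1 + X ^ 2 : ℂ[X]) ^ m).natDegree ≤ m * 2 := natDegree_pow_le_of_le m hX
    have key : (arctanNum p q (m + 1)).natDegree ≤ l + m := by
      rw [arctanNum]
      refine (natDegree_sub_le _ _).trans (max_le ((natDegree_add_le _ _).trans
        (max_le ?_ ?_)) ?_)
      · rcases le_or_gt m l with hm | hm
        · have := natDegree_iterate_derivative p m
          exact natDegree_mul_le.trans (by lia)
        · simp [iterate_derivative_eq_zero (hp.trans_lt hm)]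
      · rcases Nat.eq_zero_or_pos (arctanNum p q m).natDegree with h0 | h0
        · simp [derivative_of_natDegree_zero h0]
        · have := natDegree_derivative_le (arctanNum p q m)
          have := (natDegree_lt_iff_degree_lt (by rintro h; simp [h] at h0)).2 ih
          exact natDegree_mul_le.trans (by lia)
      · rcases eq_or_ne (arctanNum p q m) 0 with h0 | h0
        · simp [h0]
        · have := (natDegree_lt_iff_degree_lt h0).2 ih
          rw [mul_assoc]
          refine (natDegree_C_mul_le _ _).trans (natDegree_mul_le.trans ?_)
          rw [natDegree_X]
          lia
    exact (degree_le_of_natDegree_le key).trans_lt (by norm_cast; lia)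

theorem natDegree_le_of_ode (N : ℂ[X]) (l k : ℕ) (hl : l < k) (hN : N.degree < (l + k : ℕ))
    (h : (1 + X ^ 2) * derivative (derivative N) - C (2 * (k - 1) : ℂ) * X * derivative N +
      C (k * (k - 1) - l * (l + 1) : ℂ) * N = 0) : N.natDegree ≤ k - 1 := by
  by_contra! hd
  have hN0 : N ≠ 0 := by rintro rfl; simp at hd
  rw [degree_eq_natDegree hN0, Nat.cast_lt] at hN
  obtain ⟨e, he⟩ : ∃ e, N.natDegree = e + 2 := ⟨N.natDegree - 2, by lia⟩
  have hc : N.coeff (e + 2) ≠ 0 := by rw [← he]; exact leadingCoeff_ne_zero.2 hN0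
  have h4 : N.coeff (e + 2 + 1 + 1) = 0 := coeff_eq_zero_of_natDegree_lt (by lia)
  have h' := congrArg (fun p => p.coeff (e + 2)) h
  simp only [add_mul, one_mul, mul_assoc, coeff_add, coeff_sub, coeff_C_mul, coeff_derivative,
    coeff_X_mul, coeff_zero, coeff_X_pow_mul, h4] at h'
  obtain ⟨j, hj⟩ : ∃ j, e + 2 = k + j := ⟨e + 2 - k, by lia⟩
  have hjl : j < l := by lia
  have hj' : (e + 2 : ℂ) = k + j := by exact_mod_cast hj
  have hzero : ((j * (j + 1) - l * (l + 1) : ℂ)) * N.coeff (e + 2) = 0 := by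
    have : (e : ℂ) = k + j - 2 := by linear_combination hj'
    push_cast at h'
    rw [this] at h'
    linear_combination h'
  have := (mul_eq_zero.1 hzero).resolve_right hc
  have : j * (j + 1) = l * (l + 1) := by exact_mod_cast sub_eq_zero.1 this
  nlinarith

theorem tendsto_eval_div_one_add_sq_pow (P : ℂ[X]) (m : ℕ) (hP : P.natDegree < 2 * m)
    (f : Filter ℝ) (hf : Tendsto (fun x : ℝ => |x|) f atTop) :
    Tendsto (fun x : ℝ => P.eval (x : ℂ) / (1 + (x : ℂ) ^ 2) ^ m) f (nhds 0) := by
  set A := ∑ i ∈ Finset.range (P.natDegree + 1), ‖P.coeff i‖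
  have hA : 0 ≤ A := Finset.sum_nonneg fun _ _ => norm_nonneg _
  have ht : Tendsto (fun x : ℝ => A / |x|) f (nhds 0) := hf.const_div_atTop A
  refine squeeze_zero_norm' ?_ ht
  filter_upwards [hf.eventually_ge_atTop 1] with x hx
  have hx0 : 0 < |x| := by linarith
  have hnum : ‖P.eval (x : ℂ)‖ ≤ A * |x| ^ P.natDegree := by
    rw [eval_eq_sum_range, Finset.sum_mul]
    refine (norm_sum_le _ _).trans (Finset.sum_le_sum fun i hi => ?_)
    rw [norm_mul, norm_pow, Complex.norm_real, Real.norm_eq_abs]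
    exact mul_le_mul_of_nonneg_left
      (pow_le_pow_right₀ hx (by simpa [Nat.lt_succ_iff] using hi)) (norm_nonneg _)
  have hden : |x| ^ (2 * m) ≤ ‖(1 + (x : ℂ) ^ 2) ^ m‖ := by
    have : (1 + (x : ℂ) ^ 2) = ((1 + x ^ 2 : ℝ) : ℂ) := by push_cast; rfl
    rw [norm_pow, this, Complex.norm_real, Real.norm_of_nonneg (by positivity), pow_mul, sq_abs]
    exact pow_le_pow_left₀ (sq_nonneg x) (by linarith) m
  rw [norm_div, div_le_div_iff₀ ((pow_pos hx0 _).trans_le hden) hx0]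
  calc ‖P.eval (x : ℂ)‖ * |x| ≤ A * |x| ^ P.natDegree * |x| := by gcongr
    _ = A * |x| ^ (P.natDegree + 1) := by ring
    _ ≤ A * |x| ^ (2 * m) := by gcongr; lia
    _ ≤ _ := by gcongr

/-- For `l < k` the `k`-th derivative of `Q_l` on the imaginary axis is rational, with a numerator
of low degree that satisfies the differentiated Legendre equation. -/
theorem exists_iteratedDeriv_legQImag_eq (k l : ℕ) (hl : l < k) :
    ∃ N : ℂ[X], N.natDegree ≤ k - 1 ∧
      (1 + X ^ 2) * derivative (derivative N) - C (2 * (k - 1) : ℂ) * X * derivative N +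
        C (k * (k - 1) - l * (l + 1) : ℂ) * N = 0 ∧
      ∀ x : ℝ, iteratedDeriv k (legQImag l) x = N.eval (x : ℂ) / (1 + (x : ℂ) ^ 2) ^ k := by
  obtain ⟨p, q, hp, hq, h⟩ := exists_legQImag_eq l
  have h0 : legQImag l = arctanDeriv p q 0 := funext fun x => by
    simp [h x, arctanDeriv, arctanNum]
  have hode := arctanNum_ode p q (l * (l + 1)) k (hp.trans_lt hl)
    (arctanDeriv_ode p q _ (fun x => by
      rw [← h0]
      exact legQImag_ode l _ _ (fun x => h0 ▸ hasDerivAt_arctanDeriv p q 0 x)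
        (hasDerivAt_arctanDeriv p q 1) x) k)
  refine ⟨arctanNum p q k, natDegree_le_of_ode _ l k hl (degree_arctanNum_lt p q l hp hq k) hode,
    hode, fun x => ?_⟩
  rw [h0, iteratedDeriv_arctanDeriv, arctanDeriv, iterate_derivative_eq_zero (hp.trans_lt hl)]
  simp

theorem integral_eval_mul_eval_div_eq_zero (k l n : ℕ) (hk : 2 ≤ k) (hln : l ≠ n) (M N : ℂ[X])
    (hM : M.natDegree ≤ k - 1) (hN : N.natDegree ≤ k - 1)
    (hMode : (1 + X ^ 2) * derivative (derivative M) - C (2 * (k - 1) : ℂ) * X * derivative M +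
      C (k * (k - 1) - l * (l + 1) : ℂ) * M = 0)
    (hNode : (1 + X ^ 2) * derivative (derivative N) - C (2 * (k - 1) : ℂ) * X * derivative N +
      C (k * (k - 1) - n * (n + 1) : ℂ) * N = 0) :
    ∫ x : ℝ, M.eval (x : ℂ) * N.eval (x : ℂ) / (1 + (x : ℂ) ^ 2) ^ k = 0 := by
  by_cases hint : Integrable fun x : ℝ => M.eval (x : ℂ) * N.eval (x : ℂ) / (1 + (x : ℂ) ^ 2) ^ k
  swap
  · exact integral_undef hint
  obtain ⟨m, rfl⟩ : ∃ m, k = m + 1 := ⟨k - 1, by lia⟩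
  set T := derivative M * N - M * derivative N with hT
  have hTdeg : T.natDegree < 2 * m := by
    refine ((natDegree_sub_le _ _).trans (max_le (natDegree_mul_le.trans ?_)
      (natDegree_mul_le.trans ?_))).trans_lt (b := 2 * m - 1) (by lia)
    · have := natDegree_derivative_le M
      lia
    · have := natDegree_derivative_le N
      lia
  have hlam : (l * (l + 1) - n * (n + 1) : ℂ) ≠ 0 := by
    rw [sub_ne_zero]
    norm_cast
    rcases hln.lt_or_gt with h | h <;> nlinarith
  have hderiv : ∀ x : ℝ, HasDerivAt (fun t : ℝ => T.eval (t : ℂ) / (1 + (t : ℂ) ^ 2) ^ m)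
      ((l * (l + 1) - n * (n + 1) : ℂ) *
        (M.eval (x : ℂ) * N.eval (x : ℂ) / (1 + (x : ℂ) ^ 2) ^ (m + 1))) x := fun x => by
    refine (hasDerivAt_eval_div_one_add_sq_pow T m x).congr_deriv ?_
    rw [← mul_div_assoc]
    congr 1
    have hMx := congrArg (eval (x : ℂ)) hMode
    have hNx := congrArg (eval (x : ℂ)) hNode
    simp only [hT, derivative_sub, derivative_mul, eval_add, eval_sub, eval_mul, eval_pow, eval_X,
      eval_C, eval_one, eval_zero] at hMx hNx ⊢
    push_cast at hMx hNx
    linear_combination N.eval (x : ℂ) * hMx - M.eval (x : ℂ) * hNx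
  have h := integral_of_hasDerivAt_of_tendsto hderiv (hint.const_mul _)
    (tendsto_eval_div_one_add_sq_pow T m hTdeg _ tendsto_abs_atBot_atTop)
    (tendsto_eval_div_one_add_sq_pow T m hTdeg _ tendsto_abs_atTop_atTop)
  rw [integral_const_mul, sub_zero] at h
  exact (mul_eq_zero.1 h).resolve_left hlam

end ImaginaryAxis

/-- Orthogonality of `Q^k_ℓ(i·x)` and `Q^k_n(i·x)` for `ℓ ≠ n`, `ℓ, n < k`. -/
theorem legendreQ_imag_orthogonal (k l n : ℕ) (hl : l < k) (hn : n < k) (hln : l ≠ n) :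
    ∫ x : ℝ, Qi k l x * Qi k n x = 0 := by
  obtain ⟨M, hM, hMode, hMx⟩ := exists_iteratedDeriv_legQImag_eq k l hl
  obtain ⟨N, hN, hNode, hNx⟩ := exists_iteratedDeriv_legQImag_eq k n hn
  have hQ : ∀ x : ℝ, Qi k l x * Qi k n x = ((-1) ^ k * Complex.I ^ (-(k : ℤ))) ^ 2 *
      (M.eval (x : ℂ) * N.eval (x : ℂ) / (1 + (x : ℂ) ^ 2) ^ k) := fun x => by
    have hv := one_add_ofReal_sq_ne_zero x
    have hpow : (((1 + x ^ 2) ^ ((k : ℝ) / 2) : ℝ) : ℂ) ^ 2 = (1 + (x : ℂ) ^ 2) ^ k := by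
      rw [← Complex.ofReal_pow, ← Real.rpow_mul_natCast (by positivity)]
      simp
    have hMx' := hMx x
    have hNx' := hNx x
    unfold legQImag at hMx' hNx'
    rw [Qi, Qi, hMx', hNx']
    generalize (((1 + x ^ 2) ^ ((k : ℝ) / 2) : ℝ) : ℂ) = r at hpow
    generalize Complex.I ^ (-(k : ℤ)) = c
    generalize (-1 : ℂ) ^ k = s
    have hV := pow_ne_zero k hv
    rw [← hpow] at hV ⊢
    have hr : r ≠ 0 := by rintro rfl; simp at hV
    field_simp
  simp only [hQ]
  rw [integral_const_mul, integral_eval_mul_eval_div_eq_zero k l n (by lia) hln M N hM hN hMode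
    hNode, mul_zero]
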